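/- arXiv:2010.12300 — 2 statements merged into one kernel-verified Lean document; each statement's English description precedes it below -/
import Mathlib

section
/- Let x₁, …, x_t ∈ ℝ^d with ‖x_s‖ ≤ x_max, let y₁, …, y_t ∈ ℝ, and let μ : ℝ → ℝ be a strictly increasing continuously differentiable function. Set V_t = Σ_{s=1}^t x_s x_sᵀ and suppose V_t is positive definite with smallest eigenvalue λ_min(V_t). Let β₀ ∈ ℝ^d, Z_t = Σ_{s=1}^t (y_s − μ(β₀ᵀ x_s)) x_s, and let β̂ ∈ ℝ^d solve Σ_{s=1}^t x_s (y_s − μ(β̂ᵀ x_s)) = 0. Suppose κ > 0 is such that μ'(βᵀ x) ≥ κ for every x with ‖x‖ ≤ x_max and every β on the line segment between β̂ and β₀. Then Z_tᵀ V_t^{-1} Z_t ≥ κ² λ_min(V_t) ‖β̂ − β₀‖². -/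
open MeasureTheory Filter Matrix

/-- The smallest eigenvalue of a (symmetric) matrix, as the infimum of its quadratic
form over the Euclidean unit sphere. -/
noncomputable def lambdaMin {n : Type*} [Fintype n] (M : Matrix n n ℝ) : ℝ :=
  ⨅ v : {v : EuclideanSpace ℝ n // ‖v‖ = 1}, v.1 ⬝ᵥ M.mulVec v.1

/-- The quadratic form of a positive semidefinite matrix dominates `lambdaMin` times the squared
Euclidean norm. -/
lemma lambdaMin_mul_norm_sq_le {n : Type*} [Fintype n] {M : Matrix n n ℝ} (hM : M.PosSemidef)
    (v : EuclideanSpace ℝ n) : lambdaMin M * ‖v‖ ^ 2 ≤ v ⬝ᵥ M.mulVec v := by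
  rcases eq_or_ne v 0 with rfl | hv
  · simp
  have hpos : 0 < ‖v‖ := norm_pos_iff.mpr hv
  have hunit : ‖(‖v‖⁻¹ • v : EuclideanSpace ℝ n)‖ = 1 := by
    rw [norm_smul, norm_inv, norm_norm, inv_mul_cancel₀ hpos.ne']
  have hbdd : BddBelow (Set.range fun u : {u : EuclideanSpace ℝ n // ‖u‖ = 1} =>
      u.1 ⬝ᵥ M.mulVec u.1) := by
    refine ⟨0, ?_⟩
    rintro _ ⟨u, rfl⟩
    simpa using hM.dotProduct_mulVec_nonneg u.1.ofLp
  have hle : lambdaMin M ≤ ‖v‖⁻¹ * (‖v‖⁻¹ * (v ⬝ᵥ M.mulVec v)) := by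
    simpa [lambdaMin, mulVec_smul] using ciInf_le hbdd ⟨‖v‖⁻¹ • v, hunit⟩
  calc lambdaMin M * ‖v‖ ^ 2
      ≤ ‖v‖⁻¹ * (‖v‖⁻¹ * (v ⬝ᵥ M.mulVec v)) * ‖v‖ ^ 2 := by gcongr
    _ = v ⬝ᵥ M.mulVec v := by field_simp

/-- A lower bound on the derivative over a segment makes the function strongly monotone between its
endpoints. -/
lemma mul_sub_sq_le_of_le_deriv_segment {f : ℝ → ℝ} (hf : Differentiable ℝ f) {a b κ : ℝ}
    (hκ : ∀ c ∈ segment ℝ a b, κ ≤ deriv f c) :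
    κ * (a - b) ^ 2 ≤ (f a - f b) * (a - b) := by
  have key := (convex_segment a b).mul_sub_le_image_sub_of_le_deriv
    hf.continuous.continuousOn hf.differentiableOn
    (fun c hc => hκ c (interior_subset hc))
  rcases le_total a b with h | h
  · nlinarith [key a (left_mem_segment ℝ a b) b (right_mem_segment ℝ a b) h]
  · nlinarith [key b (right_mem_segment ℝ a b) a (left_mem_segment ℝ a b) h]

/-- Young's inequality for the dual pair of quadratic forms of `M` and `M⁻¹`. -/
lemma Matrix.PosDef.two_mul_dotProduct_sub_le {n : Type*} [Fintype n] [DecidableEq n]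
    {M : Matrix n n ℝ} (hM : M.PosDef) (u z : n → ℝ) :
    2 * (u ⬝ᵥ z) - u ⬝ᵥ M.mulVec u ≤ z ⬝ᵥ M⁻¹.mulVec z := by
  have hz : M.mulVec (M⁻¹.mulVec z) = z := by
    rw [mulVec_mulVec, mul_nonsing_inv _ ((isUnit_iff_isUnit_det M).mp hM.isUnit), one_mulVec]
  have hsymm : M⁻¹.mulVec z ⬝ᵥ M.mulVec u = u ⬝ᵥ z := by
    have hT : Mᵀ = M := by simpa using hM.isHermitian.eq
    rw [dotProduct_mulVec, ← mulVec_transpose, hT, hz, dotProduct_comm]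
  have hnonneg := hM.posSemidef.dotProduct_mulVec_nonneg (M⁻¹.mulVec z - u)
  simp only [star_trivial, mulVec_sub, hz, dotProduct_sub, sub_dotProduct, hsymm] at hnonneg
  linarith [dotProduct_comm (M⁻¹.mulVec z) z]

/-- The quadratic form of a Gram-type sum of rank-one matrices is a sum of squares. -/
lemma dotProduct_sum_vecMulVec_mulVec {n ι : Type*} [Fintype n] [Fintype ι]
    (x : ι → n → ℝ) (u : n → ℝ) :
    u ⬝ᵥ (∑ s, vecMulVec (x s) (x s)).mulVec u = ∑ s, (u ⬝ᵥ x s) ^ 2 := by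
  rw [sum_mulVec, dotProduct_sum]
  refine Finset.sum_congr rfl fun s _ => ?_
  simp [vecMulVec_mulVec, dotProduct_comm (x s) u, sq]

/-- key inequality in the proof of Proposition 1 of "Perturbed Pricing".
Let `x₁, …, x_t ∈ ℝ^d` with `‖x_s‖ ≤ x_max`, `y₁, …, y_t ∈ ℝ`, and let `μ` be strictly
increasing and continuously differentiable. Set `V_t = Σ_s x_s x_sᵀ` (assumed positive
definite), `Z_t = Σ_s (y_s − μ(β₀ᵀ x_s)) x_s`, and let `β̂` solve the maximum
quasi-likelihood equation `Σ_s x_s (y_s − μ(β̂ᵀ x_s)) = 0`. If `μ'(βᵀ x) ≥ κ > 0` for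
every `x` with `‖x‖ ≤ x_max` and every `β` on the segment between `β̂` and `β₀`, then
`Z_tᵀ V_t⁻¹ Z_t ≥ κ² λ_min(V_t) ‖β̂ − β₀‖²`. -/
theorem mqle_quadratic_form_lower_bound
    {d t : ℕ}
    (x : Fin t → EuclideanSpace ℝ (Fin d)) (y : Fin t → ℝ)
    (x_max : ℝ) (hx : ∀ s, ‖x s‖ ≤ x_max)
    (μ : ℝ → ℝ) (hμmono : StrictMono μ) (hμdiff : ContDiff ℝ 1 μ)
    (β₀ βhat : EuclideanSpace ℝ (Fin d))
    (V : Matrix (Fin d) (Fin d) ℝ)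
    (hV : V = ∑ s, vecMulVec (x s) (x s))
    (hVpd : V.PosDef)
    (Z : EuclideanSpace ℝ (Fin d))
    (hZ : (Z : Fin d → ℝ) = ∑ s, (y s - μ (β₀ ⬝ᵥ x s)) • (x s : Fin d → ℝ))
    -- `β̂` solves the maximum quasi-likelihood estimating equation
    (hMQLE : ∑ s, (y s - μ (βhat ⬝ᵥ x s)) • (x s : Fin d → ℝ) = 0)
    (κ : ℝ) (hκpos : 0 < κ)
    (hκ : ∀ v : EuclideanSpace ℝ (Fin d), ‖v‖ ≤ x_max →
      ∀ β ∈ segment ℝ βhat β₀, κ ≤ deriv μ (β ⬝ᵥ v)) :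
    κ ^ 2 * lambdaMin V * ‖βhat - β₀‖ ^ 2 ≤ Z ⬝ᵥ V⁻¹.mulVec Z := by
  have hquad : (βhat.ofLp - β₀.ofLp) ⬝ᵥ V.mulVec (βhat.ofLp - β₀.ofLp) =
      ∑ s, (βhat ⬝ᵥ x s - β₀ ⬝ᵥ x s) ^ 2 := by
    rw [hV, dotProduct_sum_vecMulVec_mulVec (fun s => (x s : Fin d → ℝ))]
    simp only [sub_dotProduct]
  have hZ' : (Z : Fin d → ℝ) =
      ∑ s, (μ (βhat ⬝ᵥ x s) - μ (β₀ ⬝ᵥ x s)) • (x s : Fin d → ℝ) := by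
    rw [hZ, ← sub_zero (∑ s, _), ← hMQLE, ← Finset.sum_sub_distrib]
    refine Finset.sum_congr rfl fun s _ => ?_
    rw [← sub_smul]
    congr 1
    ring
  have hmono : κ * ((βhat.ofLp - β₀.ofLp) ⬝ᵥ V.mulVec (βhat.ofLp - β₀.ofLp)) ≤
      (βhat.ofLp - β₀.ofLp) ⬝ᵥ Z := by
    rw [hquad, hZ', dotProduct_sum, Finset.mul_sum]
    refine Finset.sum_le_sum fun s _ => ?_
    rw [dotProduct_smul, smul_eq_mul, sub_dotProduct]
    refine mul_sub_sq_le_of_le_deriv_segment (hμdiff.differentiable (by norm_num)) ?_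
    rintro _ ⟨p, q, hp, hq, hpq, rfl⟩
    simpa [add_dotProduct] using hκ (x s) (hx s) (p • βhat + q • β₀) ⟨p, q, hp, hq, hpq, rfl⟩
  have hyoung := hVpd.two_mul_dotProduct_sub_le (κ • (βhat.ofLp - β₀.ofLp)) Z
  simp only [mulVec_smul, dotProduct_smul, smul_dotProduct, smul_eq_mul] at hyoung
  have hmin : lambdaMin V * ‖βhat - β₀‖ ^ 2 ≤
      (βhat.ofLp - β₀.ofLp) ⬝ᵥ V.mulVec (βhat.ofLp - β₀.ofLp) :=
    lambdaMin_mul_norm_sq_le hVpd.posSemidef (βhat - β₀)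
  nlinarith [mul_le_mul_of_nonneg_left hmono hκpos.le,
    mul_le_mul_of_nonneg_left hmin (sq_nonneg κ)]
end

section
/- For every b ≥ 0, the function f(p) = p + (max(√(1 − p) − b√p, 0))² on [0, 1] satisfies min_{p ∈ [0,1]} f(p) ≥ 1 / ((b + 1)² + 1). -/
/-- Lemma 9 of "Perturbed Pricing". For every `b ≥ 0`, the function
`f(p) = p + (max(√(1 − p) − b √p, 0))²` on `[0, 1]` is bounded below by
`1 / ((b + 1)² + 1)`. -/
theorem perturbed_pricing_scalar_min_bound
    (b : ℝ) (hb : 0 ≤ b) :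
    ∀ p ∈ Set.Icc (0 : ℝ) 1,
      1 / ((b + 1) ^ 2 + 1) ≤
        p + (max (Real.sqrt (1 - p) - b * Real.sqrt p) 0) ^ 2 := by
  rintro p ⟨hp0, hp1⟩
  have hs := Real.sq_sqrt hp0
  have hc := Real.sq_sqrt (sub_nonneg.2 hp1)
  have hc0 := Real.sqrt_nonneg (1 - p)
  have hle := le_max_left (√(1 - p) - b * √p) 0
  generalize max (√(1 - p) - b * √p) 0 = m at *
  generalize √p = s at *
  generalize √(1 - p) = c at *
  have hsq : c ^ 2 ≤ (b * s + m) ^ 2 := pow_le_pow_left₀ hc0 (by linarith) 2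
  -- Cauchy–Schwarz for the vectors `(b, 1)` and `(s, m)`.
  have hcs : (b * s + m) ^ 2 ≤ (b ^ 2 + 1) * (s ^ 2 + m ^ 2) := by
    linarith [sq_nonneg (b * m - s)]
  rw [div_le_iff₀ (by positivity), ← hs]
  have hbs : 0 ≤ b * (s ^ 2 + m ^ 2) := by positivity
  linarith [sq_nonneg m]
end
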